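/- For every constant c > 0 there is a constant C(c) > 0 such that for every n, every positive integer f with f ≤ c·n^{2/9}, and every weighted graph G on n vertices, there exists an f-EFT 5-emulator H of G with |E(H)| ≤ C(c)·n^{4/3}. -/

import Mathlib

open SimpleGraph
open scoped ENNReal

noncomputable section

/-- Weighted distance in a graph: the infimum, over all walks from `u` to `v`,
of the total weight of the walk's edges (`⊤` if there is no walk). -/
def wdist {V : Type} (G : SimpleGraph V) (w : Sym2 V → ℝ≥0∞) (u v : V) : ℝ≥0∞ :=
  ⨅ p : G.Walk u v, (p.edges.map w).sum

/-- Distance in a graph `H` whose edge `(x, y)` is (re)weighted to `δ x y`. -/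
def emulDist {V : Type} (H : SimpleGraph V) (δ : V → V → ℝ≥0∞) (u v : V) : ℝ≥0∞ :=
  ⨅ p : H.Walk u v, (p.darts.map (fun d => δ d.toProd.1 d.toProd.2)).sum

/-- `H` is an `f`-edge-fault-tolerant `t`-emulator of the weighted graph `(G, w)`:
for every fault set `F ⊆ E(G)` with `|F| ≤ f`, the graph `H` with every edge `(x,y)`
reweighted to `dist_{G∖F}(x,y)` approximates all distances of `G ∖ F` within factor `t`. -/
def IsEFTEmulator {V : Type} (G : SimpleGraph V) (w : Sym2 V → ℝ≥0∞)
    (H : SimpleGraph V) (f : ℕ) (t : ℝ≥0∞) : Prop :=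
  ∀ F : Finset (Sym2 V), ↑F ⊆ G.edgeSet → F.card ≤ f →
    ∀ u v : V,
      wdist (G.deleteEdges ↑F) w u v ≤ emulDist H (wdist (G.deleteEdges ↑F) w) u v ∧
      emulDist H (wdist (G.deleteEdges ↑F) w) u v ≤ t * wdist (G.deleteEdges ↑F) w u v

/-- `e` is the last edge of the list `l` in the order given by the ranking `π`. -/
def IsLastEdge {V : Type} (π : Sym2 V → ℕ) (l : List (Sym2 V)) (e : Sym2 V) : Prop :=
  e ∈ l ∧ ∀ e' ∈ l, π e' ≤ π e

/-- The cycle `p` is blocked by the unordered pair `b` of edges: both members of `b`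
lie on `p` and one of them is the last edge of `p` in the order `π`. -/
def CycleBlockedBy {V : Type} {H : SimpleGraph V} (π : Sym2 V → ℕ) {u : V}
    (p : H.Walk u u) (b : Sym2 (Sym2 V)) : Prop :=
  ∃ e1 e2 : Sym2 V, b = s(e1, e2) ∧ e1 ∈ p.edges ∧ e2 ∈ p.edges ∧ IsLastEdge π p.edges e1

/-- `B` is a `2k` double-blocking set for `H` with edge order `π`: it consists of
unordered pairs of distinct edges of `H`, every cycle with at most `2k` edges is blocked
by a member of `B`, and every cycle with at most `k+1` edges is blocked by two
distinct members of `B`. -/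
def IsDoubleBlockingSet {V : Type} (H : SimpleGraph V) (π : Sym2 V → ℕ) (k : ℕ)
    (B : Finset (Sym2 (Sym2 V))) : Prop :=
  (∀ b ∈ B, ¬ b.IsDiag ∧ ∀ e ∈ b, e ∈ H.edgeSet) ∧
  (∀ (u : V) (p : H.Walk u u), p.IsCycle → p.length ≤ 2 * k →
      ∃ b ∈ B, CycleBlockedBy π p b) ∧
  (∀ (u : V) (p : H.Walk u u), p.IsCycle → p.length ≤ k + 1 →
      ∃ b1 ∈ B, ∃ b2 ∈ B, b1 ≠ b2 ∧ CycleBlockedBy π p b1 ∧ CycleBlockedBy π p b2)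

/-- The number of pairs of `B` containing the edge `e`. -/
def edgeBlockCount {V : Type} (B : Finset (Sym2 (Sym2 V))) (e : Sym2 V) : ℕ :=
  {b ∈ (B : Set (Sym2 (Sym2 V))) | e ∈ b}.ncard

/-- The `i`-th edge of the vertex sequence `v`. -/
def edgeOf {V : Type} {k : ℕ} (v : Fin (k + 1) → V) (i : Fin k) : Sym2 V :=
  s(v i.castSucc, v i.succ)

/-- The average degree `2|E(H)|/n` of a graph on `n` vertices. -/
def avgDeg {V : Type} [Fintype V] (H : SimpleGraph V) : ℝ :=
  2 * (H.edgeSet.ncard : ℝ) / (Fintype.card V : ℝ)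

end
noncomputable section

/-- `v` is a SCUM `k`-path (for odd `k`), viewed as an oriented sequence of `k+1`
distinct pairwise-adjacent vertices: it is simple, its middle edge (the edge with
0-indexed position `(k-1)/2`, i.e. the index `j` with `2j+1 = k`) is the last edge
of the path in the order `π`, and the two oriented subpaths starting from the middle
edge and going towards either endpoint are chain-unblocked with respect to `B`. -/
def IsSCUM {V : Type} (H : SimpleGraph V) (π : Sym2 V → ℕ) (B : Finset (Sym2 (Sym2 V)))
    (k : ℕ) (v : Fin (k + 1) → V) : Prop :=
  Function.Injective v ∧
  (∀ i : Fin k, H.Adj (v i.castSucc) (v i.succ)) ∧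
  (∀ i j : Fin k, 2 * (j : ℕ) + 1 = k → π (edgeOf v i) ≤ π (edgeOf v j)) ∧
  (∀ (i : Fin k) (j : Fin (k + 1)), 2 * (i : ℕ) + 1 ≤ k → (j : ℕ) + 1 ≤ (i : ℕ) →
      ∀ e' : Sym2 V, s(edgeOf v i, e') ∈ B → v j ∉ e') ∧
  (∀ (i : Fin k) (j : Fin (k + 1)), k ≤ 2 * (i : ℕ) + 1 → (i : ℕ) + 2 ≤ (j : ℕ) →
      ∀ e' : Sym2 V, s(edgeOf v i, e') ∈ B → v j ∉ e')

/-- The number of (oriented) SCUM `k`-paths of `H`. -/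
def scumCount {V : Type} (H : SimpleGraph V) (π : Sym2 V → ℕ)
    (B : Finset (Sym2 (Sym2 V))) (k : ℕ) : ℕ :=
  {v : Fin (k + 1) → V | IsSCUM H π B k v}.ncard

/-- The number of (oriented, aligned) SCUM `k`-path meets of `H`: pairs of distinct
SCUM `k`-paths sharing both endpoints. -/
def scumMeetCount {V : Type} (H : SimpleGraph V) (π : Sym2 V → ℕ)
    (B : Finset (Sym2 (Sym2 V))) (k : ℕ) : ℕ :=
  {vv : (Fin (k + 1) → V) × (Fin (k + 1) → V) |
    IsSCUM H π B k vv.1 ∧ IsSCUM H π B k vv.2 ∧ vv.1 ≠ vv.2 ∧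
    vv.1 0 = vv.2 0 ∧ vv.1 (Fin.last k) = vv.2 (Fin.last k)}.ncard

/-- The oriented path given by the vertex sequence `a` is chain-unblocked with
respect to `B`: for any edge `e` of the path and any vertex `x` strictly following
`e` along the path, no pair `{e, e'} ∈ B` has `e'` incident on `x`. -/
def ChainUnblockedSeq {V : Type} (B : Finset (Sym2 (Sym2 V))) {L : ℕ}
    (a : Fin (L + 1) → V) : Prop :=
  ∀ (i : Fin L) (j : Fin (L + 1)), (i : ℕ) + 2 ≤ (j : ℕ) →
    ∀ e' : Sym2 V, s(edgeOf a i, e') ∈ B → a j ∉ e'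

/-- The walk `p` is blocked: some pair of `B` has both its edges on `p`. -/
def PathBlocked {V : Type} {H : SimpleGraph V} (B : Finset (Sym2 (Sym2 V)))
    {u v : V} (p : H.Walk u v) : Prop :=
  ∃ b ∈ B, ∀ e ∈ b, e ∈ p.edges

/-- The walk `p` is double-blocked: two distinct pairs of `B` have both their edges on `p`. -/
def PathDoubleBlocked {V : Type} {H : SimpleGraph V} (B : Finset (Sym2 (Sym2 V)))
    {u v : V} (p : H.Walk u v) : Prop :=
  ∃ b1 ∈ B, ∃ b2 ∈ B, b1 ≠ b2 ∧ (∀ e ∈ b1, e ∈ p.edges) ∧ (∀ e ∈ b2, e ∈ p.edges)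

/-- The subgraph of `H` consisting of the edge `e` together with all edges
preceding it in the order `π`. -/
def subEdges {V : Type} (H : SimpleGraph V) (π : Sym2 V → ℕ) (e : Sym2 V) : SimpleGraph V :=
  SimpleGraph.fromEdgeSet {e' ∈ H.edgeSet | π e' ≤ π e}

/-- `e` is a core edge of `H` (with respect to edge order `π` and degree threshold `d/4`):
`e` survives in the graph obtained from the subgraph of edges up to `e` by iteratively
deleting vertices of degree at most `d/4`; equivalently, there is a set `S` of vertices
containing both endpoints of `e` on which the subgraph of edges up to `e` induces
a graph of minimum degree greater than `d/4`. -/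
def IsCoreEdge {V : Type} (H : SimpleGraph V) (π : Sym2 V → ℕ) (d : ℝ) (e : Sym2 V) : Prop :=
  e ∈ H.edgeSet ∧
  ∃ S : Set V, (∀ x ∈ e, x ∈ S) ∧
    ∀ v ∈ S, d / 4 < ({u ∈ S | (subEdges H π e).Adj v u}.ncard : ℝ)

end

section Distances

variable {V : Type}

theorem wdist_triangle (G : SimpleGraph V) (w : Sym2 V → ℝ≥0∞) (u v x : V) :
    wdist G w u x ≤ wdist G w u v + wdist G w v x := by
  unfold wdist
  simp only [ENNReal.iInf_add, ENNReal.add_iInf]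
  exact le_iInf fun p => le_iInf fun q => (iInf_le _ (q.append p)).trans (by simp)

theorem wdist_le_of_adj {G : SimpleGraph V} (w : Sym2 V → ℝ≥0∞) {u v : V} (h : G.Adj u v) :
    wdist G w u v ≤ w s(u, v) :=
  (iInf_le _ h.toWalk).trans (by simp)

theorem wdist_self (G : SimpleGraph V) (w : Sym2 V → ℝ≥0∞) (u : V) : wdist G w u u = 0 :=
  le_antisymm ((iInf_le _ Walk.nil).trans (by simp)) zero_le

theorem wdist_comm (G : SimpleGraph V) (w : Sym2 V → ℝ≥0∞) (u v : V) :
    wdist G w u v = wdist G w v u := by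
  have key : ∀ a b : V, wdist G w a b ≤ wdist G w b a := fun a b =>
    le_iInf fun p => (iInf_le _ p.reverse).trans
      (by rw [Walk.edges_reverse, List.map_reverse, List.sum_reverse])
  exact le_antisymm (key u v) (key v u)

theorem emulDist_triangle (H : SimpleGraph V) (δ : V → V → ℝ≥0∞) (u v x : V) :
    emulDist H δ u x ≤ emulDist H δ u v + emulDist H δ v x := by
  unfold emulDist
  simp only [ENNReal.iInf_add, ENNReal.add_iInf]
  exact le_iInf fun p => le_iInf fun q => (iInf_le _ (q.append p)).trans (by simp)

theorem emulDist_le_of_adj {H : SimpleGraph V} (δ : V → V → ℝ≥0∞) {u v : V} (h : H.Adj u v) :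
    emulDist H δ u v ≤ δ u v :=
  (iInf_le _ h.toWalk).trans (by simp)

theorem emulDist_self (H : SimpleGraph V) (δ : V → V → ℝ≥0∞) (u : V) : emulDist H δ u u = 0 :=
  le_antisymm ((iInf_le _ Walk.nil).trans (by simp)) zero_le

theorem emulDist_comm (H : SimpleGraph V) {δ : V → V → ℝ≥0∞} (hδ : ∀ a b, δ a b = δ b a)
    (u v : V) : emulDist H δ u v = emulDist H δ v u := by
  have key : ∀ a b : V, emulDist H δ a b ≤ emulDist H δ b a := fun a b =>
    le_iInf fun p => (iInf_le _ p.reverse).trans (le_of_eq (by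
      rw [Walk.darts_reverse, List.map_reverse, List.sum_reverse, List.map_map]
      congr 1
      exact List.map_congr_left fun d _ => hδ _ _))
  exact le_antisymm (key u v) (key v u)

theorem emulDist_anti {H₁ H₂ : SimpleGraph V} (h : H₁ ≤ H₂) (δ : V → V → ℝ≥0∞) (u v : V) :
    emulDist H₂ δ u v ≤ emulDist H₁ δ u v := by
  refine le_iInf fun p => ?_
  induction p with
  | nil => rw [emulDist_self]; exact zero_le
  | @cons a b c hab p ih =>
    refine (emulDist_triangle H₂ δ a b c).trans ?_
    rw [Walk.darts_cons, List.map_cons, List.sum_cons]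
    exact add_le_add (emulDist_le_of_adj δ (h hab)) ih

theorem wdist_le_emulDist (G H : SimpleGraph V) (w : Sym2 V → ℝ≥0∞) (u v : V) :
    wdist G w u v ≤ emulDist H (wdist G w) u v := by
  refine le_iInf fun p => ?_
  induction p with
  | nil => rw [wdist_self]; exact zero_le
  | @cons a b c hab p ih =>
    refine (wdist_triangle G w a b c).trans ?_
    rw [Walk.darts_cons, List.map_cons, List.sum_cons]
    gcongr

/-- A stretch bound on the edges of `G` extends to all pairs of vertices. -/
theorem emulDist_le_mul_wdist {G H : SimpleGraph V} {w : Sym2 V → ℝ≥0∞} {δ : V → V → ℝ≥0∞}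
    {t : ℝ≥0∞} (h : ∀ x y, G.Adj x y → emulDist H δ x y ≤ t * w s(x, y)) (ht₀ : t ≠ 0)
    (ht : t ≠ ⊤) (u v : V) :
    emulDist H δ u v ≤ t * wdist G w u v := by
  unfold wdist
  rw [ENNReal.mul_iInf_of_ne ht₀ ht]
  refine le_iInf fun p => ?_
  induction p with
  | nil => rw [emulDist_self]; exact zero_le
  | @cons a b c hab p ih =>
    refine (emulDist_triangle H δ a b c).trans ?_
    rw [Walk.edges_cons, List.map_cons, List.sum_cons, mul_add]
    exact add_le_add (h a b hab) ih

end Distances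

section Greedy

/-- A greedy selection in the order given by `π`: whether `e` is selected depends on the
elements selected before it. -/
theorem exists_greedy_set {ε α : Type*} [Finite ε] [LinearOrder α] (π : ε → α)
    (Q : ε → Set ε → Prop) : ∃ S : Set ε, ∀ e, e ∈ S ↔ Q e {e' | e' ∈ S ∧ π e' < π e} := by
  have hwf : WellFounded (fun a b : ε => π a < π b) := by
    have : Std.Irrefl (fun a b : ε => π a < π b) := ⟨fun _ => lt_irrefl _⟩
    have : IsTrans ε (fun a b : ε => π a < π b) := ⟨fun _ _ _ => lt_trans⟩
    exact Finite.wellFounded_of_trans_of_irrefl _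
  refine ⟨{e | hwf.fix (C := fun _ => Prop)
    (fun e ih => Q e {e' | ∃ h : π e' < π e, ih e' h}) e}, fun e => ?_⟩
  rw [Set.mem_ofPred_eq, hwf.fix_eq]
  have : ∀ A B : Set ε, A = B → (Q e A ↔ Q e B) := by rintro A _ rfl; rfl
  apply this
  ext e'
  simp only [Set.mem_ofPred_eq, exists_prop]
  exact and_comm

variable {V : Type} {α : Type*} [LinearOrder α]

/-- `F` assigns to every edge of `H` at most `f` edges, such that the closed walks of length
at most six on which `s(x, y)` strictly dominates all other edges in the order `π` meet
`F s(x, y)`, and those of length four do so in at least two positions. -/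
structure IsFaultBlocking (H : SimpleGraph V) (π : Sym2 V → α)
    (F : Sym2 V → Finset (Sym2 V)) (f : ℕ) : Prop where
  card_le : ∀ e, (F e).card ≤ f
  three : ∀ x y a, H.Adj x y → (H.Adj x a ∧ π s(x, a) < π s(x, y)) →
    (H.Adj a y ∧ π s(a, y) < π s(x, y)) → s(x, a) ∈ F s(x, y) ∨ s(a, y) ∈ F s(x, y)
  four : ∀ x y a b, H.Adj x y → (H.Adj x a ∧ π s(x, a) < π s(x, y)) →
    (H.Adj a b ∧ π s(a, b) < π s(x, y)) → (H.Adj b y ∧ π s(b, y) < π s(x, y)) →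
    (s(x, a) ∈ F s(x, y) ∨ s(a, b) ∈ F s(x, y)) ∧ (s(a, b) ∈ F s(x, y) ∨ s(b, y) ∈ F s(x, y))
  six : ∀ x y a b c d, H.Adj x y → (H.Adj x a ∧ π s(x, a) < π s(x, y)) →
    (H.Adj a b ∧ π s(a, b) < π s(x, y)) → (H.Adj b c ∧ π s(b, c) < π s(x, y)) →
    (H.Adj c d ∧ π s(c, d) < π s(x, y)) → (H.Adj d y ∧ π s(d, y) < π s(x, y)) →
    s(x, a) ∈ F s(x, y) ∨ s(a, b) ∈ F s(x, y) ∨ s(b, c) ∈ F s(x, y) ∨ s(c, d) ∈ F s(x, y) ∨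
      s(d, y) ∈ F s(x, y)

/-- The greedy construction gives an emulator whose short cycles are blocked. -/
theorem exists_emulator_isFaultBlocking [Finite V] (G : SimpleGraph V) (w : Sym2 V → ℝ≥0∞)
    (f : ℕ) (π : Sym2 V → α) (hπw : ∀ e e', π e < π e' → w e ≤ w e') :
    ∃ (H : SimpleGraph V) (F : Sym2 V → Finset (Sym2 V)),
      IsEFTEmulator G w H f 5 ∧ IsFaultBlocking H π F f := by
  obtain ⟨S, hS⟩ := exists_greedy_set π (fun e S => e ∈ G.edgeSet ∧ ∃ F : Finset (Sym2 V),
    ↑F ⊆ G.edgeSet ∧ F.card ≤ f ∧ e ∉ F ∧ ∃ x y, e = s(x, y) ∧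
      5 * w e < emulDist (fromEdgeSet S) (wdist (G.deleteEdges ↑F) w) x y)
  have hSG : ∀ e ∈ S, e ∈ G.edgeSet := fun e he => ((hS e).1 he).1
  have hadj : ∀ x y, (fromEdgeSet S).Adj x y ↔ s(x, y) ∈ S := by
    intro x y
    rw [fromEdgeSet_adj]
    exact ⟨fun h => h.1, fun h => ⟨h, (G.mem_edgeSet.1 (hSG _ h)).ne⟩⟩
  have hfault : ∀ e, ∃ F : Finset (Sym2 V), F.card ≤ f ∧ (e ∈ S → e ∉ F ∧ ∀ x y, e = s(x, y) →
      5 * w e < emulDist (fromEdgeSet {e' | e' ∈ S ∧ π e' < π e})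
        (wdist (G.deleteEdges ↑F) w) x y) := by
    intro e
    by_cases he : e ∈ S
    · obtain ⟨-, F, -, hFf, heF, x, y, hxy, hlt⟩ := (hS e).1 he
      refine ⟨F, hFf, fun _ => ⟨heF, fun a b hab => ?_⟩⟩
      rcases Sym2.eq_iff.1 (hxy.symm.trans hab) with ⟨rfl, rfl⟩ | ⟨rfl, rfl⟩
      · exact hlt
      · rwa [emulDist_comm _ (wdist_comm _ _)]
    · exact ⟨∅, by simp, fun h => absurd h he⟩
  choose F hFcard hF using hfault
  refine ⟨fromEdgeSet S, F, ?_, ?_⟩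
  · intro X hXG hXf u v
    refine ⟨wdist_le_emulDist _ _ _ _ _, emulDist_le_mul_wdist ?_ (by simp) (by simp) u v⟩
    intro x y hxy
    by_cases hmem : s(x, y) ∈ S
    · refine (emulDist_le_of_adj _ ((hadj x y).2 hmem)).trans ((wdist_le_of_adj w hxy).trans ?_)
      exact le_mul_of_one_le_left zero_le (by norm_num)
    · rw [deleteEdges_adj] at hxy
      by_contra hlt
      rw [not_le] at hlt
      refine hmem ((hS _).2 ⟨hxy.1, X, hXG, hXf, by simpa using hxy.2, x, y, rfl,
        hlt.trans_le (emulDist_anti ?_ _ _ _)⟩)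
      exact fromEdgeSet_mono fun e he => he.1
  · have hlow : ∀ {x y a b}, ((fromEdgeSet S).Adj a b ∧ π s(a, b) < π s(x, y)) →
        (fromEdgeSet {e' | e' ∈ S ∧ π e' < π s(x, y)}).Adj a b := by
      intro x y a b h
      rw [fromEdgeSet_adj]
      exact ⟨⟨(hadj _ _).1 h.1, h.2⟩, h.1.ne⟩
    have hδ : ∀ {x y a b}, ((fromEdgeSet S).Adj a b ∧ π s(a, b) < π s(x, y)) →
        s(a, b) ∉ F s(x, y) →
        wdist (G.deleteEdges ↑(F s(x, y))) w a b ≤ w s(x, y) := by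
      intro x y a b h hn
      refine (wdist_le_of_adj w ?_).trans (hπw _ _ h.2)
      rw [deleteEdges_adj]
      exact ⟨hSG _ ((hadj _ _).1 h.1), by simpa using hn⟩
    refine ⟨hFcard, ?_, ?_, ?_⟩
    · intro x y a hxy h₁ h₂
      by_contra! hn
      obtain ⟨-, hlt⟩ := hF _ ((hadj _ _).1 hxy)
      refine (hlt x y rfl).not_ge ?_
      calc _ ≤ _ := emulDist_triangle _ _ x a y
        _ ≤ _ := add_le_add (emulDist_le_of_adj _ (hlow h₁)) (emulDist_le_of_adj _ (hlow h₂))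
        _ ≤ w s(x, y) + w s(x, y) := add_le_add (hδ h₁ hn.1) (hδ h₂ hn.2)
        _ = 2 * w s(x, y) := by ring
        _ ≤ _ := by gcongr; norm_num
    · intro x y a b hxy h₁ h₂ h₃
      obtain ⟨hnF, hlt⟩ := hF _ ((hadj _ _).1 hxy)
      have hlt := hlt x y rfl
      set δ := wdist (G.deleteEdges ↑(F s(x, y))) w with hδdef
      have htri : ∀ p q r, δ p r ≤ δ p q + δ q r := wdist_triangle _ _
      have hcomm : ∀ p q, δ p q = δ q p := wdist_comm _ _
      have hbase : δ x y ≤ w s(x, y) := by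
        refine wdist_le_of_adj w ?_
        rw [deleteEdges_adj]
        exact ⟨hSG _ ((hadj _ _).1 hxy), by simpa using hnF⟩
      have hsum : emulDist (fromEdgeSet {e' | e' ∈ S ∧ π e' < π s(x, y)}) δ x y ≤
          δ x a + (δ a b + δ b y) :=
        calc _ ≤ _ := emulDist_triangle _ _ x a y
          _ ≤ _ := add_le_add_right (emulDist_triangle _ _ a b y) _
          _ ≤ _ := add_le_add (emulDist_le_of_adj _ (hlow h₁))
            (add_le_add (emulDist_le_of_adj _ (hlow h₂)) (emulDist_le_of_adj _ (hlow h₃)))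
      have hthree : ∀ p q r s, δ p q ≤ w s(x, y) → δ q r ≤ w s(x, y) → δ r s ≤ w s(x, y) →
          δ p s ≤ 3 * w s(x, y) := fun p q r s h h' h'' =>
        calc _ ≤ _ := htri p q s
          _ ≤ _ := add_le_add_right (htri q r s) _
          _ ≤ w s(x, y) + (w s(x, y) + w s(x, y)) := add_le_add h (add_le_add h' h'')
          _ = _ := by ring
      constructor
      · by_contra! hn
        refine hlt.not_ge (hsum.trans ?_)
        have e₁ := hδ h₁ hn.1
        have e₂ := hδ h₂ hn.2
        rw [← hδdef] at e₁ e₂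
        have e₃ := hthree b a x y (hcomm b a ▸ e₂) (hcomm a x ▸ e₁) hbase
        calc _ ≤ w s(x, y) + (w s(x, y) + 3 * w s(x, y)) :=
              add_le_add e₁ (add_le_add e₂ e₃)
          _ = _ := by ring
      · by_contra! hn
        refine hlt.not_ge (hsum.trans ?_)
        have e₂ := hδ h₂ hn.1
        have e₃ := hδ h₃ hn.2
        rw [← hδdef] at e₂ e₃
        have e₁ := hthree x y b a hbase (hcomm y b ▸ e₃) (hcomm b a ▸ e₂)
        calc _ ≤ 3 * w s(x, y) + (w s(x, y) + w s(x, y)) :=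
              add_le_add e₁ (add_le_add e₂ e₃)
          _ = _ := by ring
    · intro x y a b c d hxy h₁ h₂ h₃ h₄ h₅
      by_contra! hn
      obtain ⟨-, hlt⟩ := hF _ ((hadj _ _).1 hxy)
      refine (hlt x y rfl).not_ge ?_
      have hE : ∀ {p q}, ((fromEdgeSet S).Adj p q ∧ π s(p, q) < π s(x, y)) →
          s(p, q) ∉ F s(x, y) → emulDist (fromEdgeSet {e' | e' ∈ S ∧ π e' < π s(x, y)})
            (wdist (G.deleteEdges ↑(F s(x, y))) w) p q ≤ w s(x, y) := fun h hn =>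
        (emulDist_le_of_adj _ (hlow h)).trans (hδ h hn)
      calc _ ≤ _ := emulDist_triangle _ _ x a y
        _ ≤ _ := add_le_add_right (emulDist_triangle _ _ a b y) _
        _ ≤ _ := add_le_add_right (add_le_add_right (emulDist_triangle _ _ b c y) _) _
        _ ≤ _ := add_le_add_right (add_le_add_right (add_le_add_right
          (emulDist_triangle _ _ c d y) _) _) _
        _ ≤ w s(x, y) + (w s(x, y) + (w s(x, y) + (w s(x, y) + w s(x, y)))) :=
          add_le_add (hE h₁ hn.1) (add_le_add (hE h₂ hn.2.1) (add_le_add (hE h₃ hn.2.2.1)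
            (add_le_add (hE h₄ hn.2.2.2.1) (hE h₅ hn.2.2.2.2))))
        _ = _ := by ring

/-- The path `s, x, y, t` is middle-heavy with respect to `π`, and its endpoints avoid the edges
of `F s(x, y)`. -/
structure IsHeavyPath (H : SimpleGraph V) (π : Sym2 V → α) (F : Sym2 V → Finset (Sym2 V))
    (s x y t : V) : Prop where
  adj : H.Adj x y
  left : H.Adj s x ∧ π s(s, x) < π s(x, y)
  right : H.Adj y t ∧ π s(y, t) < π s(x, y)
  left_notMem : ∀ e ∈ F s(x, y), s ∉ e
  right_notMem : ∀ e ∈ F s(x, y), t ∉ e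

/-- Two heavy paths with common endpoints have disjoint middle edges, and the later middle edge
is blocked by the earlier one. -/
theorem IsFaultBlocking.mem_of_isHeavyPath {H : SimpleGraph V} {π : Sym2 V → α}
    {F : Sym2 V → Finset (Sym2 V)} {f : ℕ} (hF : IsFaultBlocking H π F f)
    (hπ : Function.Injective π) {s t x y x' y' : V} (hp : IsHeavyPath H π F s x y t)
    (hq : IsHeavyPath H π F s x' y' t) (hne : ¬ (x = x' ∧ y = y'))
    (hle : π s(x', y') ≤ π s(x, y)) :
    x ≠ x' ∧ y ≠ y' ∧ s(x', y') ∈ F s(x, y) := by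
  have hs : ∀ z, s(s, z) ∉ F s(x, y) := fun z h => hp.left_notMem _ h (Sym2.mem_mk_left _ _)
  have hs' : ∀ z, s(z, s) ∉ F s(x, y) := fun z h => hp.left_notMem _ h (Sym2.mem_mk_right _ _)
  have ht : ∀ z, s(t, z) ∉ F s(x, y) := fun z h => hp.right_notMem _ h (Sym2.mem_mk_left _ _)
  have ht' : ∀ z, s(z, t) ∉ F s(x, y) := fun z h => hp.right_notMem _ h (Sym2.mem_mk_right _ _)
  have h₁ : H.Adj x s ∧ π s(x, s) < π s(x, y) :=
    ⟨hp.left.1.symm, by rw [Sym2.eq_swap]; exact hp.left.2⟩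
  have h₂ : H.Adj s x' ∧ π s(s, x') < π s(x, y) := ⟨hq.left.1, hq.left.2.trans_le hle⟩
  have h₄ : H.Adj y' t ∧ π s(y', t) < π s(x, y) := ⟨hq.right.1, hq.right.2.trans_le hle⟩
  have h₅ : H.Adj t y ∧ π s(t, y) < π s(x, y) :=
    ⟨hp.right.1.symm, by rw [Sym2.eq_swap]; exact hp.right.2⟩
  rcases hle.eq_or_lt with heq | hlt
  · exfalso
    rcases Sym2.eq_iff.1 (hπ heq) with ⟨rfl, rfl⟩ | ⟨rfl, rfl⟩
    · exact hne ⟨rfl, rfl⟩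
    · exact (hF.three _ _ s hp.adj h₁ h₂).elim (hs' _) (hs _)
  have h₃ : H.Adj x' y' ∧ π s(x', y') < π s(x, y) := ⟨hq.adj, hlt⟩
  refine ⟨?_, ?_, ?_⟩
  · rintro rfl
    exact (hF.four _ _ y' t hp.adj h₃ h₄ h₅).2.elim (ht' _) (ht _)
  · rintro rfl
    exact (hF.four _ _ s x' hp.adj h₁ h₂ h₃).1.elim (hs' _) (hs _)
  · have := hF.six _ _ s x' y' t hp.adj h₁ h₂ h₃ h₄ h₅
    grind

end Greedy

section Counting

open Finset Classical

variable {V : Type} [Fintype V] {α : Type*} [LinearOrder α] {H : SimpleGraph V}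
  {π : Sym2 V → α} {F : Sym2 V → Finset (Sym2 V)} {f : ℕ}

theorem IsFaultBlocking.card_commonNeighbors_le_of_isMax (hF : IsFaultBlocking H π F f)
    (hπ : Function.Injective π) {x z s₀ : V} (hxz : x ≠ z) (hx₀ : H.Adj x s₀) (hz₀ : H.Adj z s₀)
    (hx : ∀ s, H.Adj x s → H.Adj z s → π s(x, s) ≤ π s(x, s₀))
    (hz : ∀ s, H.Adj x s → H.Adj z s → π s(z, s) ≤ π s(x, s₀)) :
    #{s | H.Adj x s ∧ H.Adj z s} ≤ f + 1 := by
  rw [← card_erase_add_one (a := s₀) (by simp [hx₀, hz₀])]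
  refine Nat.add_le_add_right (le_trans ?_ (hF.card_le s(x, s₀))) 1
  refine card_le_card_of_injOn
    (fun s => if s(x, s) ∈ F s(x, s₀) then s(x, s) else s(s, z)) ?_ ?_
  · intro s hs
    simp only [coe_erase, coe_filter, mem_univ, true_and, Set.mem_sdiff, Set.mem_ofPred_eq,
      Set.mem_singleton_iff] at hs
    obtain ⟨⟨hxs, hzs⟩, hne⟩ := hs
    have h₁ : π s(x, s) < π s(x, s₀) := by
      refine lt_of_le_of_ne (hx s hxs hzs) fun h => ?_
      have := hπ h
      rw [Sym2.eq_iff] at this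
      grind
    have h₂ : π s(s, z) < π s(x, s₀) := by
      refine lt_of_le_of_ne (Sym2.eq_swap (a := s) ▸ hz s hxs hzs) fun h => ?_
      have := hπ h
      rw [Sym2.eq_iff] at this
      have := hxs.ne
      grind
    have h₃ : π s(z, s₀) < π s(x, s₀) := by
      refine lt_of_le_of_ne (hz s₀ hx₀ hz₀) fun h => ?_
      have := hπ h
      rw [Sym2.eq_iff] at this
      have := hz₀.ne
      grind
    have := (hF.four x s₀ s z hx₀ ⟨hxs, h₁⟩ ⟨hzs.symm, h₂⟩ ⟨hz₀, h₃⟩).1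
    simp only [mem_coe]
    split_ifs with h
    · exact h
    · exact this.resolve_left h
  · intro s hs s' hs' h
    simp only [coe_erase, coe_filter, mem_univ, true_and, Set.mem_sdiff, Set.mem_ofPred_eq,
      Set.mem_singleton_iff] at hs hs'
    have h₁ := hs.1.1.ne
    have h₂ := hs.1.2.ne
    have h₃ := hs'.1.1.ne
    have h₄ := hs'.1.2.ne
    simp only at h
    split_ifs at h <;> rw [Sym2.eq_iff] at h <;> grind

/-- Two distinct vertices have at most `f + 1` common neighbors. -/
theorem IsFaultBlocking.card_commonNeighbors_le (hF : IsFaultBlocking H π F f)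
    (hπ : Function.Injective π) {x z : V} (hxz : x ≠ z) :
    #{s | H.Adj x s ∧ H.Adj z s} ≤ f + 1 := by
  rcases (univ.filter fun s => H.Adj x s ∧ H.Adj z s).eq_empty_or_nonempty with h | h
  · rw [h]; simp
  obtain ⟨a, ha, hamax⟩ := exists_max_image _ (fun s => π s(x, s)) h
  obtain ⟨b, hb, hbmax⟩ := exists_max_image _ (fun s => π s(z, s)) h
  simp only [mem_filter, mem_univ, true_and] at ha hb hamax hbmax
  rcases le_total (π s(z, b)) (π s(x, a)) with hle | hle
  · exact hF.card_commonNeighbors_le_of_isMax hπ hxz ha.1 ha.2 (fun s h h' => hamax s ⟨h, h'⟩)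
      (fun s h h' => (hbmax s ⟨h, h'⟩).trans hle)
  · simp only [and_comm (a := H.Adj x _)]
    exact hF.card_commonNeighbors_le_of_isMax hπ hxz.symm hb.2 hb.1
      (fun s h h' => hbmax s ⟨h', h⟩) (fun s h h' => (hamax s ⟨h', h⟩).trans hle)

theorem card_adj_pairs (H : SimpleGraph V) :
    #{q : V × V | H.Adj q.1 q.2} = 2 * H.edgeSet.ncard := by
  rw [Set.ncard_eq_toFinset_card', Set.toFinset_card, ← edgeFinset_card,
    ← sum_degrees_eq_twice_card_edges, card_filter, Fintype.sum_prod_type]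
  refine sum_congr rfl fun x _ => ?_
  rw [← card_filter, ← card_neighborFinset_eq_degree]
  congr 1
  ext; simp

theorem card_pairs_mem_le (X : Finset (Sym2 V)) : #{q : V × V | s(q.1, q.2) ∈ X} ≤ 2 * #X := by
  refine card_le_mul_card_image_of_maps_to (f := fun q : V × V => s(q.1, q.2))
    (fun q hq => (mem_filter.1 hq).2) 2 fun e _ => ?_
  induction e with | _ a b => ?_
  refine (card_le_card (t := {(a, b), (b, a)}) ?_).trans card_le_two
  intro q hq
  have := Sym2.eq_iff.1 (mem_filter.1 hq).2
  simp only [mem_insert, mem_singleton, Prod.ext_iff]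
  exact this

theorem card_vertices_mem_le (X : Finset (Sym2 V)) : #{v : V | ∃ e ∈ X, v ∈ e} ≤ 2 * #X := by
  have : (univ.filter fun v : V => ∃ e ∈ X, v ∈ e) ⊆ X.biUnion Sym2.toFinset := by
    intro v; simp
  refine (card_le_card this).trans ((card_biUnion_le_card_mul _ _ 2 fun e _ => ?_).trans_eq
    (mul_comm _ _))
  rw [Sym2.card_toFinset]
  split_ifs <;> omega

theorem card_filter_rank_lt_le {β : Type*} (N : Finset β) {g : β → α}
    (hg : Function.Injective g) (D : ℕ) : #{y ∈ N | #{s ∈ N | g s < g y} < D} ≤ D := by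
  conv_rhs => rw [← card_range D]
  refine card_le_card_of_injOn (fun y => #{s ∈ N | g s < g y})
    (fun y hy => by simpa using (mem_filter.1 hy).2) ?_
  have key : ∀ y ∈ N, ∀ z, g y < g z → #{s ∈ N | g s < g y} < #{s ∈ N | g s < g z} := by
    intro y hy z hyz
    refine card_lt_card (ssubset_iff_of_subset (fun s hs => ?_) |>.2 ⟨y, ?_, ?_⟩)
    · rw [mem_filter] at hs ⊢
      exact ⟨hs.1, hs.2.trans hyz⟩
    · simp [hy, hyz]
    · simp
  intro y hy z hz h
  have hy := (mem_filter.1 hy).1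
  have hz := (mem_filter.1 hz).1
  rcases lt_trichotomy (g y) (g z) with hlt | heq | hlt
  · exact absurd h (key y hy z hlt).ne
  · exact hg heq
  · exact absurd h.symm (key z hz y hlt).ne

/-- Heavy paths, given as a pair of endpoints and a middle edge. -/
noncomputable def heavyPaths (H : SimpleGraph V) (π : Sym2 V → α) (F : Sym2 V → Finset (Sym2 V)) :
    Finset ((V × V) × (V × V)) :=
  {p | p.1.1 ≠ p.1.2 ∧ IsHeavyPath H π F p.1.1 p.2.1 p.2.2 p.1.2}

/-- The number of neighbors of `x` whose edge to `x` precedes `e`. -/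
noncomputable def lowerDegree (H : SimpleGraph V) (π : Sym2 V → α) (e : Sym2 V) (x : V) : ℕ :=
  #{s | H.Adj x s ∧ π s(x, s) < π e}

theorem card_lowerDegree_lt_le (hπ : Function.Injective π) (D : ℕ) :
    #{q : V × V | H.Adj q.1 q.2 ∧ lowerDegree H π s(q.1, q.2) q.1 < D} ≤
      D * Fintype.card V := by
  refine card_le_mul_card_image_of_maps_to (t := univ) (f := Prod.fst)
    (fun _ _ => mem_univ _) D fun x _ => ?_
  refine le_trans ?_ (card_filter_rank_lt_le {s | H.Adj x s} (g := fun s => π s(x, s)) ?_ D)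
  · refine card_le_card_of_injOn Prod.snd ?_ ?_
    · rintro ⟨a, b⟩ hq
      simp only [coe_filter, mem_filter, mem_univ, true_and, Set.mem_ofPred_eq] at hq ⊢
      obtain ⟨⟨h, h'⟩, rfl⟩ := hq
      refine ⟨h, ?_⟩
      rwa [filter_filter]
    · rintro ⟨a, b⟩ hq ⟨a', b'⟩ hq' h
      simp only [coe_filter, mem_filter, mem_univ, true_and, Set.mem_ofPred_eq] at hq hq'
      grind
  · intro a b h
    have := Sym2.eq_iff.1 (hπ h)
    grind

/-- At least half of the oriented edges have lower degree at least `D` at both endpoints. -/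
theorem le_card_lowerDegree_ge (hπ : Function.Injective π) (D : ℕ) :
    2 * H.edgeSet.ncard ≤ #{q : V × V | H.Adj q.1 q.2 ∧ D ≤ lowerDegree H π s(q.1, q.2) q.1 ∧
      D ≤ lowerDegree H π s(q.1, q.2) q.2} + 2 * (D * Fintype.card V) := by
  have hswap : #{q : V × V | H.Adj q.1 q.2 ∧ lowerDegree H π s(q.1, q.2) q.2 < D} ≤
      D * Fintype.card V := by
    refine le_trans ?_ (card_lowerDegree_lt_le (H := H) hπ D)
    refine card_le_card_of_injOn Prod.swap ?_ Prod.swap_injective.injOn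
    intro q hq
    simp only [coe_filter, mem_univ, true_and, Set.mem_ofPred_eq] at hq ⊢
    exact ⟨hq.1.symm, by simpa [Sym2.eq_swap] using hq.2⟩
  rw [← card_adj_pairs, two_mul (D * _), ← add_assoc]
  refine le_trans ?_ (Nat.add_le_add (Nat.add_le_add_left (card_lowerDegree_lt_le (H := H) hπ D) _)
    hswap)
  refine le_trans (card_le_card ?_) ((card_union_le _ _).trans
    (Nat.add_le_add_right (card_union_le _ _) _))
  intro q hq
  simp only [mem_union, mem_filter, mem_univ, true_and] at hq ⊢
  grind

theorem IsFaultBlocking.lowerDegree_le (hF : IsFaultBlocking H π F f) (e : Sym2 V) (x : V) :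
    lowerDegree H π e x ≤
      #{s | (H.Adj x s ∧ π s(x, s) < π e) ∧ ∀ e' ∈ F e, s ∉ e'} + 2 * f := by
  refine le_trans ?_ (Nat.add_le_add_left ((card_vertices_mem_le (F e)).trans
    (Nat.mul_le_mul_left 2 (hF.card_le e))) _)
  refine le_trans (card_le_card ?_) (card_union_le _ _)
  intro s hs
  simp only [mem_union, mem_filter, mem_univ, true_and] at hs ⊢
  grind

theorem IsFaultBlocking.le_card_heavyPaths (hF : IsFaultBlocking H π F f) (D : ℕ) :
    #{q : V × V | H.Adj q.1 q.2 ∧ D ≤ lowerDegree H π s(q.1, q.2) q.1 ∧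
      D ≤ lowerDegree H π s(q.1, q.2) q.2} * ((D - 2 * f) * (D - 2 * f - 1)) ≤
      #(heavyPaths H π F) := by
  set Q : Finset (V × V) := {q : V × V | H.Adj q.1 q.2 ∧
    D ≤ lowerDegree H π s(q.1, q.2) q.1 ∧ D ≤ lowerDegree H π s(q.1, q.2) q.2} with hQ
  rw [card_eq_sum_card_fiberwise (s := heavyPaths H π F) (f := Prod.snd) (t := univ)
    (fun _ _ => mem_univ _)]
  refine le_trans ?_ (sum_le_sum_of_subset (subset_univ Q))
  rw [← smul_eq_mul]
  refine card_nsmul_le_sum _ _ _ fun q hq => ?_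
  obtain ⟨x, y⟩ := q
  simp only [hQ, mem_filter, mem_univ, true_and] at hq
  obtain ⟨hxy, hx, hy⟩ := hq
  set A : Finset V := {s | (H.Adj x s ∧ π s(x, s) < π s(x, y)) ∧ ∀ e' ∈ F s(x, y), s ∉ e'} with hA
  set B : Finset V := {s | (H.Adj y s ∧ π s(y, s) < π s(x, y)) ∧ ∀ e' ∈ F s(x, y), s ∉ e'} with hB
  have hAc : D ≤ #A + 2 * f := hx.trans (hF.lowerDegree_le _ _)
  have hBc : D ≤ #B + 2 * f := hy.trans (hF.lowerDegree_le _ _)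
  have hsub : ((A.sigma fun s => B.erase s).map
      ⟨fun p => ((p.1, p.2), (x, y)), fun p q h => by
        obtain ⟨a, b⟩ := p
        obtain ⟨c, d⟩ := q
        simp only [Prod.mk.injEq, and_true] at h
        obtain ⟨rfl, rfl⟩ := h
        rfl⟩ : Finset ((V × V) × (V × V))) ⊆
      (heavyPaths H π F).filter fun p => p.2 = (x, y) := by
    intro p hp
    simp only [mem_map, mem_sigma, mem_erase] at hp
    obtain ⟨⟨s, t⟩, ⟨hs, hts, ht⟩, rfl⟩ := hp
    simp only [hA, hB, mem_filter, mem_univ, true_and] at hs ht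
    exact mem_filter.2 ⟨mem_filter.2 ⟨mem_univ _, hts.symm, hxy,
      ⟨hs.1.1.symm, by rw [Sym2.eq_swap]; exact hs.1.2⟩, ht.1, hs.2, ht.2⟩, rfl⟩
  refine le_trans ?_ (card_le_card hsub)
  rw [card_map, card_sigma]
  calc _ ≤ #A * (D - 2 * f - 1) := Nat.mul_le_mul_right _ (by omega)
    _ ≤ _ := by
      rw [← smul_eq_mul]
      refine card_nsmul_le_sum _ _ _ fun s _ => ?_
      have := pred_card_le_card_erase (s := B) (a := s)
      omega

theorem sq_card_le_card_mul_card_filter {β γ : Type*} [Fintype γ] (T : Finset β) (g : β → γ) :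
    #T ^ 2 ≤ Fintype.card γ * #{p ∈ T ×ˢ T | g p.1 = g p.2} := by
  have h₁ : #{p ∈ T ×ˢ T | g p.1 = g p.2} = ∑ c : γ, #{a ∈ T | g a = c} ^ 2 := by
    rw [card_eq_sum_card_fiberwise (f := fun p => g p.1) (t := univ) (fun _ _ => mem_univ _)]
    refine sum_congr rfl fun c _ => ?_
    rw [sq, ← card_product]
    congr 1
    ext p
    simp only [mem_filter, mem_product]
    grind
  rw [h₁, card_eq_sum_card_fiberwise (f := g) (t := univ) (fun _ _ => mem_univ _)]
  exact sq_sum_le_card_mul_sum_sq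

/-- The pairs of heavy paths with common endpoints and disjoint middle edges, the second middle
edge blocking the first. -/
noncomputable def blockedMeets (H : SimpleGraph V) (π : Sym2 V → α)
    (F : Sym2 V → Finset (Sym2 V)) : Finset (((V × V) × (V × V)) × ((V × V) × (V × V))) :=
  {p ∈ heavyPaths H π F ×ˢ heavyPaths H π F | p.1.1 = p.2.1 ∧ p.1.2.1 ≠ p.2.2.1 ∧
    p.1.2.2 ≠ p.2.2.2 ∧ s(p.2.2.1, p.2.2.2) ∈ F s(p.1.2.1, p.1.2.2)}

theorem IsFaultBlocking.card_blockedMeets_le (hF : IsFaultBlocking H π F f)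
    (hπ : Function.Injective π) :
    #(blockedMeets H π F) ≤ (f + 1) * (f + 1) * (2 * f * (2 * H.edgeSet.ncard)) := by
  set Z : Finset ((V × V) × (V × V)) := {z | H.Adj z.1.1 z.1.2 ∧ z.1.1 ≠ z.2.1 ∧
    z.1.2 ≠ z.2.2 ∧ s(z.2.1, z.2.2) ∈ F s(z.1.1, z.1.2)} with hZ
  have hZc : #Z ≤ 2 * f * (2 * H.edgeSet.ncard) := by
    rw [← card_adj_pairs]
    refine card_le_mul_card_image_of_maps_to (f := Prod.fst) ?_ _ ?_
    · intro z hz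
      simp only [hZ, mem_filter, mem_univ, true_and] at hz ⊢
      exact hz.1
    · intro q _
      refine le_trans ?_ ((card_pairs_mem_le (F s(q.1, q.2))).trans
        (Nat.mul_le_mul_left 2 (hF.card_le _)))
      refine card_le_card_of_injOn Prod.snd ?_ ?_
      · intro z hz
        simp only [hZ, coe_filter, mem_filter, mem_univ, true_and, Set.mem_ofPred_eq] at hz ⊢
        obtain ⟨hz, rfl⟩ := hz
        exact hz.2.2.2
      · intro z hz z' hz' h
        simp only [coe_filter, Set.mem_ofPred_eq] at hz hz'
        exact Prod.ext (hz.2.trans hz'.2.symm) h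
  refine le_trans (card_le_mul_card_image_of_maps_to (t := Z)
    (f := fun p : ((V × V) × (V × V)) × ((V × V) × (V × V)) => (p.1.2, p.2.2)) ?_
    ((f + 1) * (f + 1)) ?_) (Nat.mul_le_mul_left _ hZc)
  · intro p hp
    simp only [blockedMeets, heavyPaths, hZ, mem_filter, mem_product, mem_univ,
      true_and] at hp ⊢
    exact ⟨hp.1.1.2.adj, hp.2.2⟩
  · intro z hz
    obtain ⟨⟨x, y⟩, ⟨x', y'⟩⟩ := z
    simp only [hZ, mem_filter, mem_univ, true_and] at hz
    refine le_trans ?_ (Nat.mul_le_mul (hF.card_commonNeighbors_le hπ hz.2.1)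
      (hF.card_commonNeighbors_le hπ hz.2.2.1))
    rw [← card_product]
    refine card_le_card_of_injOn (fun p => p.1.1) ?_ ?_
    · rintro ⟨⟨⟨s, t⟩, a⟩, ⟨⟨s', t'⟩, a'⟩⟩ hp
      simp only [blockedMeets, heavyPaths, coe_filter, mem_filter, mem_product, mem_univ,
        true_and, Set.mem_ofPred_eq, Prod.mk.injEq, coe_product, Set.mem_prod] at hp ⊢
      obtain ⟨⟨⟨⟨-, h₁⟩, -, h₂⟩, ⟨rfl, rfl⟩, -⟩, rfl, rfl⟩ := hp
      exact ⟨⟨h₁.left.1.symm, h₂.left.1.symm⟩, h₁.right.1, h₂.right.1⟩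
    · rintro ⟨p₁, p₂⟩ hp ⟨q₁, q₂⟩ hq h
      simp only [blockedMeets, coe_filter, mem_filter, Set.mem_ofPred_eq, Prod.mk.injEq] at hp hq h
      refine Prod.ext (Prod.ext h (hp.2.1.trans hq.2.1.symm))
        (Prod.ext ?_ (hp.2.2.trans hq.2.2.symm))
      exact hp.1.2.1.symm.trans (h.trans hq.1.2.1)

theorem IsFaultBlocking.sq_card_heavyPaths_le (hF : IsFaultBlocking H π F f)
    (hπ : Function.Injective π) :
    #(heavyPaths H π F) ^ 2 ≤ Fintype.card V ^ 2 * (#(heavyPaths H π F) +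
      2 * ((f + 1) * (f + 1) * (2 * f * (2 * H.edgeSet.ncard)))) := by
  refine (sq_card_le_card_mul_card_filter (heavyPaths H π F) Prod.fst).trans ?_
  rw [Fintype.card_prod, ← sq]
  refine Nat.mul_le_mul_left _ ?_
  refine (card_le_card (t := (heavyPaths H π F).image (fun p => (p, p)) ∪
    (blockedMeets H π F ∪ (blockedMeets H π F).image Prod.swap)) ?_).trans
      ((card_union_le _ _).trans (Nat.add_le_add card_image_le ((card_union_le _ _).trans ?_)))
  · rintro ⟨⟨⟨s, t⟩, x, y⟩, ⟨⟨s', t'⟩, x', y'⟩⟩ hp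
    simp only [mem_filter, mem_product, Prod.mk.injEq] at hp
    obtain ⟨⟨hp, hq⟩, rfl, rfl⟩ := hp
    have hp' := hp
    have hq' := hq
    simp only [heavyPaths, mem_filter, mem_univ, true_and] at hp' hq'
    by_cases heq : x = x' ∧ y = y'
    · obtain ⟨rfl, rfl⟩ := heq
      exact mem_union_left _ (mem_image.2 ⟨_, hp, rfl⟩)
    refine mem_union_right _ ?_
    rcases le_total (π s(x', y')) (π s(x, y)) with hle | hle
    · refine mem_union_left _ ?_
      simp only [blockedMeets, mem_filter, mem_product]
      exact ⟨⟨hp, hq⟩, trivial, hF.mem_of_isHeavyPath hπ hp'.2 hq'.2 heq hle⟩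
    · refine mem_union_right _ (mem_image.2 ⟨(((s, t), x', y'), ((s, t), x, y)), ?_, rfl⟩)
      simp only [blockedMeets, mem_filter, mem_product]
      exact ⟨⟨hq, hp⟩, trivial, hF.mem_of_isHeavyPath hπ hq'.2 hp'.2
        (fun h => heq ⟨h.1.symm, h.2.symm⟩) hle⟩
  · rw [two_mul]
    exact Nat.add_le_add (hF.card_blockedMeets_le hπ)
      (card_image_le.trans (hF.card_blockedMeets_le hπ))

end Counting

theorem exists_injective_refining {ε β : Type*} [Finite ε] [LinearOrder β] (w : ε → β) :
    ∃ (k : ℕ) (π : ε → β ×ₗ Fin k), Function.Injective π ∧ ∀ e e', π e < π e' → w e ≤ w e' := by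
  obtain ⟨k, ⟨g⟩⟩ := Finite.exists_equiv_fin ε
  refine ⟨k, fun e => toLex (w e, g e), fun a b h => ?_, fun a b h => ?_⟩
  · exact g.injective (Prod.ext_iff.1 (toLex.injective h)).2
  · rcases Prod.Lex.toLex_lt_toLex.1 h with h | h
    · exact h.le
    · exact h.1.le

theorem IsFaultBlocking.ncard_edgeSet_le {V : Type} [Fintype V] {α : Type*} [LinearOrder α]
    {H : SimpleGraph V} {π : Sym2 V → α} {F : Sym2 V → Finset (Sym2 V)} {f : ℕ}
    (hF : IsFaultBlocking H π F f) (hπ : Function.Injective π) (hf : 0 < f) {c N : ℝ} (hc : 0 < c)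
    (hN : 1 ≤ N) (hcard : (Fintype.card V : ℝ) = N ^ 9) (hfN : (f : ℝ) ≤ c * N ^ 2) :
    (H.edgeSet.ncard : ℝ) ≤ (16 * c + 4 + 512 * c ^ 3) * N ^ 12 := by
  by_contra! hm
  obtain ⟨g, hgood, hpath⟩ : ∃ g, _ ≤ g + _ ∧ g * _ ≤ _ :=
    ⟨_, le_card_lowerDegree_ge (H := H) hπ (H.edgeSet.ncard / (2 * Fintype.card V)),
      hF.le_card_heavyPaths (H.edgeSet.ncard / (2 * Fintype.card V))⟩
  have hmeet := hF.sq_card_heavyPaths_le hπ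
  have hDm := Nat.div_mul_le_self H.edgeSet.ncard (2 * Fintype.card V)
  have hn : 0 < Fintype.card V := by
    have : (0 : ℝ) < Fintype.card V := by rw [hcard]; positivity
    exact_mod_cast this
  have hDm' := Nat.lt_div_mul_add (a := H.edgeSet.ncard) (b := 2 * Fintype.card V) (by omega)
  set m := H.edgeSet.ncard
  set P := (heavyPaths H π F).card
  set D := m / (2 * Fintype.card V)
  have hg : m ≤ g := by nlinarith
  set C := 16 * c + 4 + 512 * c ^ 3
  have hc3 : 0 < c ^ 3 := by positivity
  have hC16 : 16 * c ≤ C := by simp only [C]; linarith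
  have hC4 : 4 ≤ C := by simp only [C]; linarith
  have hC512 : 512 * c ^ 3 ≤ C := by simp only [C]; linarith
  have hm0 : (0 : ℝ) < m := lt_trans (by positivity) hm
  have hf1 : (1 : ℝ) ≤ f := by exact_mod_cast hf
  set q : ℝ := m / (2 * N ^ 9) with hq
  have hqD : q < D + 1 := by
    have : (m : ℝ) < D * (2 * N ^ 9) + 2 * N ^ 9 := by
      rw [← hcard]; exact_mod_cast hDm'
    rw [hq, div_lt_iff₀ (by positivity)]
    linarith
  have hqN : C * N ^ 3 / 2 < q := by
    rw [hq, lt_div_iff₀ (by positivity)]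
    calc _ = C * N ^ 12 := by ring
      _ < _ := hm
  have hN23 : N ^ 2 ≤ N ^ 3 := pow_le_pow_right₀ hN (by norm_num)
  have hfq : 2 * (f : ℝ) + 2 ≤ q / 2 := by
    have h₁ : c * N ^ 2 ≤ c * N ^ 3 := mul_le_mul_of_nonneg_left hN23 hc.le
    have h₂ : 16 * c * N ^ 3 ≤ C * N ^ 3 := by gcongr
    linarith
  have hq0 : 0 < q := lt_trans (by positivity) hqN
  have hD2 : 2 * f + 1 ≤ D := by
    have : (2 * f + 1 : ℝ) < D := by linarith
    exact_mod_cast this.le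
  have hP : (m : ℝ) * (q / 2) ^ 2 ≤ P := by
    have h : ((m * ((D - 2 * f) * (D - 2 * f - 1)) : ℕ) : ℝ) ≤ P := by
      exact_mod_cast (Nat.mul_le_mul_right _ hg).trans hpath
    refine le_trans ?_ h
    rw [Nat.cast_mul, Nat.cast_mul, Nat.sub_sub, Nat.cast_sub (by omega), Nat.cast_sub (by omega)]
    push_cast
    rw [sq]
    have h₁ : q / 2 ≤ D - 2 * f := by linarith
    have h₂ : q / 2 ≤ D - (2 * f + 1) := by linarith
    gcongr
    linarith
  have hM : (P : ℝ) ^ 2 ≤ N ^ 18 * (P + 32 * c ^ 3 * N ^ 6 * m) := by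
    have h : (P : ℝ) ^ 2 ≤ (Fintype.card V : ℝ) ^ 2 * (P +
        2 * ((f + 1) * (f + 1) * (2 * f * (2 * m)))) := by exact_mod_cast hmeet
    rw [hcard, ← pow_mul] at h
    refine h.trans (mul_le_mul_of_nonneg_left (add_le_add le_rfl ?_) (by positivity))
    calc (2 * ((f + 1) * (f + 1) * (2 * f * (2 * m))) : ℝ)
        ≤ 2 * ((f + f) * (f + f) * (2 * f * (2 * m))) := by gcongr
      _ = 32 * (f : ℝ) ^ 3 * m := by ring
      _ ≤ 32 * (c * N ^ 2) ^ 3 * m := by gcongr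
      _ = _ := by ring
  have hCC : C ^ 2 * N ^ 6 / 4 ≤ q ^ 2 := by
    calc _ = (C * N ^ 3 / 2) ^ 2 := by ring
      _ ≤ _ := by gcongr
  have hP18 : 2 * N ^ 18 ≤ P := by
    refine le_trans ?_ hP
    have h64 : (4 : ℝ) ^ 3 ≤ C ^ 3 := by gcongr
    calc 2 * N ^ 18 ≤ 4 ^ 3 / 16 * N ^ 18 := by gcongr; norm_num
      _ ≤ C ^ 3 / 16 * N ^ 18 := by gcongr
      _ = (C * N ^ 12) * (C ^ 2 * N ^ 6 / 4) / 4 := by ring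
      _ ≤ m * q ^ 2 / 4 := by gcongr
      _ = _ := by ring
  have hPm : 32 * c ^ 3 * N ^ 6 * m < P := by
    refine lt_of_lt_of_le ?_ hP
    have h : 512 * c ^ 3 < C ^ 2 := by nlinarith
    calc 32 * c ^ 3 * N ^ 6 * m = 512 * c ^ 3 * (N ^ 6 * m / 16) := by ring
      _ < C ^ 2 * (N ^ 6 * m / 16) := by gcongr
      _ = m * (C ^ 2 * N ^ 6 / 4) / 4 := by ring
      _ ≤ m * q ^ 2 / 4 := by gcongr
      _ = _ := by ring
  have hN18 : (0 : ℝ) < N ^ 18 := by positivity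
  have hP0 : (0 : ℝ) < P := by linarith
  have : (P : ℝ) ^ 2 < N ^ 18 * (2 * P) :=
    hM.trans_lt (mul_lt_mul_of_pos_left (by linarith) hN18)
  nlinarith

/-- For every constant `c > 0` there is a constant `C(c) > 0` such that for
every `n`, every positive integer `f ≤ c·n^{2/9}`, and every weighted graph `G` on `n`
vertices, there exists an `f`-EFT `5`-emulator `H` of `G` with `|E(H)| ≤ C(c)·n^{4/3}`. -/
theorem statement_2 (c : ℝ) (hc : 0 < c) :
    ∃ C : ℝ, 0 < C ∧
      ∀ (V : Type) [Fintype V], ∀ (G : SimpleGraph V) (w : Sym2 V → ℝ≥0∞) (f : ℕ),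
        0 < f → (f : ℝ) ≤ c * (Fintype.card V : ℝ) ^ ((2 : ℝ) / 9) →
        (∀ e ∈ G.edgeSet, 0 < w e ∧ w e ≠ ⊤) →
        ∃ H : SimpleGraph V,
          IsEFTEmulator G w H f 5 ∧
          (H.edgeSet.ncard : ℝ) ≤ C * (Fintype.card V : ℝ) ^ ((4 : ℝ) / 3) := by
  refine ⟨16 * c + 4 + 512 * c ^ 3, by positivity, fun V _ G w f hf hfc _ => ?_⟩
  obtain ⟨k, π, hπ, hπw⟩ := exists_injective_refining w
  obtain ⟨H, F, hH, hF⟩ := exists_emulator_isFaultBlocking G w f π hπw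
  refine ⟨H, hH, ?_⟩
  have hn : 1 ≤ (Fintype.card V : ℝ) := by
    rcases Nat.eq_zero_or_pos (Fintype.card V) with h | h
    · rw [h, Nat.cast_zero, Real.zero_rpow (by norm_num), mul_zero] at hfc
      exact absurd hf (by exact_mod_cast hfc.not_gt)
    · exact_mod_cast h
  have hpow : ∀ j : ℕ, ((Fintype.card V : ℝ) ^ ((1 : ℝ) / 9)) ^ j =
      (Fintype.card V : ℝ) ^ ((j : ℝ) / 9) := fun j => by
    rw [← Real.rpow_natCast, ← Real.rpow_mul (by positivity)]
    congr 1
    ring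
  have h := hF.ncard_edgeSet_le hπ hf (N := (Fintype.card V : ℝ) ^ ((1 : ℝ) / 9)) hc
    (Real.one_le_rpow hn (by norm_num)) (by rw [hpow]; norm_num)
    (by rw [hpow]; exact_mod_cast hfc)
  rw [hpow] at h
  convert h using 3
  norm_num
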